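/- arXiv:2506.11373 — 2 statements merged into one kernel-verified Lean document; each statement's English description precedes it below -/
import Mathlib

section
/- Suppose A is Hurwitz and Q is symmetric positive definite, and let V be the unique symmetric positive definite solution of the Lyapunov equation AᵀV + VA + Q = 0. Then for every a > 0 and every symmetric positive semidefinite P ∈ ℝ^{n×n} satisfying AᵀP + PA + Q − a·P B_u B_uᵀ P = 0, one has P ≼ V in the Loewner order and a·‖P B_u B_uᵀ P‖_F ≤ 2‖A‖_F·‖V‖_F + ‖Q‖_F. -/
open Matrix Filter Topology

noncomputable section

/-- A real square matrix is Hurwitz if every complex eigenvalue has strictly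
negative real part. -/
def IsHurwitz {N : ℕ} (M : Matrix (Fin N) (Fin N) ℝ) : Prop :=
  ∀ μ : ℂ, μ ∈ spectrum ℂ (M.map (algebraMap ℝ ℂ)) → μ.re < 0

/-- Frobenius norm of a real matrix. -/
def frobNorm {p q : ℕ} (M : Matrix (Fin p) (Fin q) ℝ) : ℝ :=
  Real.sqrt (Matrix.trace (Mᵀ * M))

/-- Minimal eigenvalue of a (Hermitian) real matrix. -/
def eigMin {m : ℕ} (M : Matrix (Fin m) (Fin m) ℝ) : ℝ :=
  if hM : M.IsHermitian then ⨅ i, hM.eigenvalues i else 0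

/-- Maximal eigenvalue of a (Hermitian) real matrix. -/
def eigMax {m : ℕ} (M : Matrix (Fin m) (Fin m) ℝ) : ℝ :=
  if hM : M.IsHermitian then ⨆ i, hM.eigenvalues i else 0

variable {n m_u m_a : ℕ}

/-- `P` is the stabilizing solution of the spoofed ARE for the gain `Λ`. -/
def IsStabSol (A : Matrix (Fin n) (Fin n) ℝ) (Bu : Matrix (Fin n) (Fin m_u) ℝ)
    (Ba : Matrix (Fin n) (Fin m_a) ℝ) (Q : Matrix (Fin n) (Fin n) ℝ)
    (R : Matrix (Fin m_a) (Fin m_a) ℝ)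
    (Λ : Matrix (Fin m_u) (Fin n) ℝ) (P : Matrix (Fin n) (Fin n) ℝ) : Prop :=
  P.PosDef ∧
  (A + Bu * Λ)ᵀ * P + P * (A + Bu * Λ) + Q + P * Ba * R⁻¹ * Baᵀ * P = 0 ∧
  IsHurwitz (A + Bu * Λ + Ba * R⁻¹ * Baᵀ * P)

/-- `Pim` is a symmetric solution of the Lyapunov equation defining `Π(Λ)`,
given the stabilizing ARE solution `P = P_u(Λ)`. -/
def IsLyapSol (A : Matrix (Fin n) (Fin n) ℝ) (Bu : Matrix (Fin n) (Fin m_u) ℝ)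
    (Ba : Matrix (Fin n) (Fin m_a) ℝ) (R : Matrix (Fin m_a) (Fin m_a) ℝ)
    (Kbar : Matrix (Fin m_a) (Fin n) ℝ)
    (Λ : Matrix (Fin m_u) (Fin n) ℝ) (P Pim : Matrix (Fin n) (Fin n) ℝ) : Prop :=
  Pim.IsHermitian ∧
  (A + Bu * Λ + Ba * R⁻¹ * Baᵀ * P) * Pim + Pim * (A + Bu * Λ + Ba * R⁻¹ * Baᵀ * P)ᵀ
    - Kbarᵀ * R⁻¹ * Baᵀ - Ba * R⁻¹ * Kbar
    + P * Ba * (R⁻¹ * R⁻¹) * Baᵀ + Ba * (R⁻¹ * R⁻¹) * Baᵀ * P = 0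

/-- The deception cost `J̃(Λ)`, expressed through a choice function `Pu` for the
stabilizing solution of the spoofed ARE. -/
def Jcost (Ba : Matrix (Fin n) (Fin m_a) ℝ) (R : Matrix (Fin m_a) (Fin m_a) ℝ)
    (Γ : Matrix (Fin m_u) (Fin m_u) ℝ) (Kbar : Matrix (Fin m_a) (Fin n) ℝ)
    (Pu : Matrix (Fin m_u) (Fin n) ℝ → Matrix (Fin n) (Fin n) ℝ)
    (Λ : Matrix (Fin m_u) (Fin n) ℝ) : ℝ :=
  frobNorm (R⁻¹ * Baᵀ * Pu Λ - Kbar) ^ 2 + Matrix.trace (Λᵀ * Γ * Λ)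

/-- The sublevel set `S₀`. -/
def S0 (A : Matrix (Fin n) (Fin n) ℝ) (Bu : Matrix (Fin n) (Fin m_u) ℝ)
    (Ba : Matrix (Fin n) (Fin m_a) ℝ) (Q : Matrix (Fin n) (Fin n) ℝ)
    (R : Matrix (Fin m_a) (Fin m_a) ℝ) (Γ : Matrix (Fin m_u) (Fin m_u) ℝ)
    (Kbar : Matrix (Fin m_a) (Fin n) ℝ)
    (Pu : Matrix (Fin m_u) (Fin n) ℝ → Matrix (Fin n) (Fin n) ℝ) :
    Set (Matrix (Fin m_u) (Fin n) ℝ) :=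
  {Λ | (∃ P, IsStabSol A Bu Ba Q R Λ P) ∧
    Jcost Ba R Γ Kbar Pu Λ ≤ Jcost Ba R Γ Kbar Pu 0}

/-- The function `x ↦ xᵀ M x` attached to a real matrix is continuous. -/
theorem continuous_dotProduct_mulVec_self {N : ℕ} (M : Matrix (Fin N) (Fin N) ℝ) :
    Continuous fun x : Fin N → ℝ => x ⬝ᵥ (M *ᵥ x) := by
  fun_prop

/-- If `X` is symmetric and not positive semidefinite, and `V` is positive definite, then the pencil
`X - c V` is positive semidefinite and singular for some `c < 0`. -/
theorem exists_neg_posSemidef_sub_smul_mulVec_eq_zero {N : ℕ} {X V : Matrix (Fin N) (Fin N) ℝ}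
    (hX : X.IsHermitian) (hV : V.PosDef) (hneg : ¬ X.PosSemidef) :
    ∃ c < (0 : ℝ), ∃ v ≠ 0, (X - c • V) *ᵥ v = 0 := by
  have hVpos : ∀ x : Fin N → ℝ, x ≠ 0 → 0 < x ⬝ᵥ (V *ᵥ x) := fun x hx => by
    simpa using hV.dotProduct_mulVec_pos hx
  obtain ⟨x₀, hx₀⟩ : ∃ x₀ : Fin N → ℝ, x₀ ⬝ᵥ (X *ᵥ x₀) < 0 := by
    by_contra! h
    exact hneg (.of_dotProduct_mulVec_nonneg hX fun x => by simpa using h x)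
  have hx₀0 : x₀ ≠ 0 := by
    rintro rfl
    simp at hx₀
  set f : (Fin N → ℝ) → ℝ := fun x => x ⬝ᵥ (X *ᵥ x) / x ⬝ᵥ (V *ᵥ x) with hf
  have hscale : ∀ (r : ℝ) (x : Fin N → ℝ), r ≠ 0 → f (r • x) = f x := fun r x hr => by
    simp only [hf, mulVec_smul, dotProduct_smul, smul_dotProduct, smul_eq_mul]
    rw [mul_div_mul_left _ _ hr, mul_div_mul_left _ _ hr]
  have hnormalize : ∀ x : Fin N → ℝ, x ≠ 0 → ‖x‖⁻¹ • x ∈ Metric.sphere (0 : Fin N → ℝ) 1 :=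
    fun x hx => by
      have := norm_ne_zero_iff.mpr hx
      simp [norm_smul, this]
  have hcont : ContinuousOn f (Metric.sphere 0 1) :=
    (continuous_dotProduct_mulVec_self X).continuousOn.div
      (continuous_dotProduct_mulVec_self V).continuousOn fun x hx =>
        (hVpos x (ne_zero_of_mem_unit_sphere ⟨x, hx⟩)).ne'
  obtain ⟨v, hv, hmin⟩ := (isCompact_sphere (0 : Fin N → ℝ) 1).exists_isMinOn
    ⟨_, hnormalize x₀ hx₀0⟩ hcont
  have hv0 : v ≠ 0 := ne_zero_of_mem_unit_sphere ⟨v, hv⟩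
  have hle : ∀ x : Fin N → ℝ, x ≠ 0 → f v ≤ f x := fun x hx => by
    rw [← hscale ‖x‖⁻¹ x (inv_ne_zero (norm_ne_zero_iff.mpr hx))]
    exact hmin (hnormalize x hx)
  have hform : ∀ x : Fin N → ℝ, x ⬝ᵥ ((X - f v • V) *ᵥ x) =
      x ⬝ᵥ (X *ᵥ x) - f v * x ⬝ᵥ (V *ᵥ x) := fun x => by
    simp [sub_mulVec, smul_mulVec]
  have hpsd : (X - f v • V).PosSemidef := by
    refine .of_dotProduct_mulVec_nonneg (hX.sub ?_) fun x => ?_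
    · rw [IsHermitian, conjTranspose_smul, hV.isHermitian.eq, star_trivial]
    · rw [star_trivial, hform]
      rcases eq_or_ne x 0 with rfl | hx
      · simp
      · exact sub_nonneg.mpr ((le_div_iff₀ (hVpos x hx)).mp (hle x hx))
  refine ⟨f v, (hle x₀ hx₀0).trans_lt (div_neg_of_neg_of_pos hx₀ (hVpos x₀ hx₀0)), v, hv0, ?_⟩
  rw [← hpsd.dotProduct_mulVec_zero_iff, star_trivial, hform,
    div_mul_cancel₀ _ (hVpos v hv0).ne', sub_self]

/-- Lyapunov comparison: if `V` is positive definite with `Aᵀ V + V A` negative definite, then a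
symmetric `X` with `Aᵀ X + X A` negative semidefinite is positive semidefinite. -/
theorem posSemidef_of_lyapunov {N : ℕ} {A V Q X W : Matrix (Fin N) (Fin N) ℝ}
    (hV : V.PosDef) (hQ : Q.PosDef) (hVeq : Aᵀ * V + V * A + Q = 0)
    (hX : X.IsHermitian) (hW : W.PosSemidef) (hXeq : Aᵀ * X + X * A + W = 0) :
    X.PosSemidef := by
  by_contra hneg
  obtain ⟨c, hc, v, hv0, hker⟩ := exists_neg_posSemidef_sub_smul_mulVec_eq_zero hX hV hneg
  have hsym : (X - c • V)ᵀ = X - c • V := by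
    have hXt : Xᵀ = X := by simpa [IsHermitian] using hX
    have hVt : Vᵀ = V := by simpa [IsHermitian] using hV.isHermitian
    rw [transpose_sub, transpose_smul, hXt, hVt]
  have hlyap : Aᵀ * (X - c • V) + (X - c • V) * A = c • Q - W := by
    rw [eq_neg_of_add_eq_zero_right hVeq, eq_neg_of_add_eq_zero_right hXeq]
    simp only [mul_sub, sub_mul, mul_smul_comm, smul_mul_assoc, smul_neg, smul_add]
    abel
  have hzero : v ⬝ᵥ ((c • Q - W) *ᵥ v) = 0 := by
    rw [← hlyap, add_mulVec, ← mulVec_mulVec, ← mulVec_mulVec, hker, dotProduct_add,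
      dotProduct_mulVec v (X - c • V), ← mulVec_transpose, hsym, hker]
    simp
  have hQv : 0 < v ⬝ᵥ (Q *ᵥ v) := by simpa using hQ.dotProduct_mulVec_pos hv0
  have hWv : 0 ≤ v ⬝ᵥ (W *ᵥ v) := by simpa using hW.dotProduct_mulVec_nonneg v
  simp only [sub_mulVec, smul_mulVec, dotProduct_sub, dotProduct_smul, smul_eq_mul] at hzero
  nlinarith [mul_neg_of_neg_of_pos hc hQv]

/-- The trace of a product of two positive semidefinite matrices is nonnegative. -/
theorem trace_mul_nonneg_of_posSemidef {N : ℕ} {X Y : Matrix (Fin N) (Fin N) ℝ}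
    (hX : X.PosSemidef) (hY : Y.PosSemidef) : 0 ≤ (X * Y).trace := by
  obtain ⟨C, rfl⟩ : ∃ C : Matrix (Fin N) (Fin N) ℝ, Y = Cᴴ * C := by
    open scoped MatrixOrder in
    exact CStarAlgebra.nonneg_iff_eq_star_mul_self.mp hY.nonneg
  rw [← Matrix.mul_assoc, trace_mul_comm, ← Matrix.mul_assoc]
  exact (hX.mul_mul_conjTranspose_same C).trace_nonneg

/-- The Frobenius norm is monotone on positive semidefinite matrices. -/
theorem frobNorm_le_of_posSemidef_sub {N : ℕ} {P V : Matrix (Fin N) (Fin N) ℝ}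
    (hP : P.PosSemidef) (hV : V.PosSemidef) (h : (V - P).PosSemidef) :
    frobNorm P ≤ frobNorm V := by
  have hPt : Pᵀ = P := by simpa [IsHermitian] using hP.isHermitian
  have hVt : Vᵀ = V := by simpa [IsHermitian] using hV.isHermitian
  refine Real.sqrt_le_sqrt ?_
  rw [hPt, hVt]
  have h₁ := trace_mul_nonneg_of_posSemidef h hV
  have h₂ := trace_mul_nonneg_of_posSemidef h hP
  rw [sub_mul, trace_sub] at h₁ h₂
  linarith [trace_mul_comm P V]

section Frobenius

attribute [local instance] Matrix.frobeniusNormedAddCommGroup Matrix.frobeniusNormedSpace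

theorem frobNorm_eq_norm {p q : ℕ} (M : Matrix (Fin p) (Fin q) ℝ) : frobNorm M = ‖M‖ := by
  rw [frobenius_norm_def, frobNorm, Real.sqrt_eq_rpow, trace]
  simp only [diag_apply, mul_apply, transpose_apply]
  rw [Finset.sum_comm]
  congr! 3 with i _ j _
  simp [sq]

theorem frobNorm_smul_of_nonneg {p q : ℕ} {a : ℝ} (ha : 0 ≤ a) (M : Matrix (Fin p) (Fin q) ℝ) :
    frobNorm (a • M) = a * frobNorm M := by
  rw [frobNorm_eq_norm, frobNorm_eq_norm, norm_smul, Real.norm_of_nonneg ha]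

theorem frobNorm_nonneg {p q : ℕ} (M : Matrix (Fin p) (Fin q) ℝ) : 0 ≤ frobNorm M :=
  Real.sqrt_nonneg _

theorem frobNorm_lyapunov_le {N : ℕ} (A P Q : Matrix (Fin N) (Fin N) ℝ) :
    frobNorm (Aᵀ * P + P * A + Q) ≤ 2 * frobNorm A * frobNorm P + frobNorm Q := by
  simp only [frobNorm_eq_norm]
  have h₁ : ‖Aᵀ * P‖ ≤ ‖A‖ * ‖P‖ := by
    simpa only [frobenius_norm_transpose] using frobenius_norm_mul Aᵀ P
  have h₂ := frobenius_norm_mul P A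
  have h₃ := norm_add₃_le (a := Aᵀ * P) (b := P * A) (c := Q)
  linarith

end Frobenius

/-- comparison with the Lyapunov solution `V` and the resulting
bound on `a‖P Bu Buᵀ P‖_F`. -/
theorem stmt17
    (A : Matrix (Fin n) (Fin n) ℝ) (Bu : Matrix (Fin n) (Fin m_u) ℝ)
    (Q : Matrix (Fin n) (Fin n) ℝ) (hQ : Q.PosDef)
    (hA : IsHurwitz A)
    (V : Matrix (Fin n) (Fin n) ℝ) (hV : V.PosDef)
    (hVeq : Aᵀ * V + V * A + Q = 0) :
    ∀ a : ℝ, 0 < a → ∀ P : Matrix (Fin n) (Fin n) ℝ, P.PosSemidef →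
      Aᵀ * P + P * A + Q - a • (P * Bu * Buᵀ * P) = 0 →
      (V - P).PosSemidef ∧
      a * frobNorm (P * Bu * Buᵀ * P) ≤
        2 * frobNorm A * frobNorm V + frobNorm Q := by
  intro a ha P hP hPeq
  have hW : (a • (P * Bu * Buᵀ * P)).PosSemidef := by
    have hPt : Pᵀ = P := by simpa [IsHermitian] using hP.isHermitian
    have := posSemidef_self_mul_conjTranspose (P * Bu)
    rw [conjTranspose_eq_transpose_of_trivial, transpose_mul, hPt, ← Matrix.mul_assoc] at this
    exact this.smul ha.le
  have hVP : (V - P).PosSemidef := by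
    refine posSemidef_of_lyapunov hV hQ hVeq (hV.isHermitian.sub hP.isHermitian) hW ?_
    rw [← sub_eq_zero.mpr (hVeq.trans hPeq.symm), mul_sub, sub_mul]
    abel
  refine ⟨hVP, ?_⟩
  rw [← frobNorm_smul_of_nonneg ha.le, ← sub_eq_zero.mp hPeq]
  refine (frobNorm_lyapunov_le A P Q).trans ?_
  have := frobNorm_le_of_posSemidef_sub hP hV.posSemidef hVP
  have := frobNorm_nonneg A
  gcongr
end
end

section
/- Let Λ ∈ ℝ^{m_u×n} and K ∈ ℝ^{m_a×n} satisfy ‖S B_u‖_F·‖Λ‖_F + ‖S B_a‖_F·‖K − K*‖_F < 1. Then the matrix A + B_uΛ + B_aK is Hurwitz. -/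
open Matrix Filter Topology

noncomputable section

variable {n m_u m_a : ℕ}

/-- The Cauchy-Schwarz inequality for the dot product of real vectors. -/
theorem dotProduct_le_sqrt_mul_sqrt {p : ℕ} (u v : Fin p → ℝ) :
    u ⬝ᵥ v ≤ √(u ⬝ᵥ u) * √(v ⬝ᵥ v) := by
  simpa only [dotProduct, pow_two] using Real.sum_mul_le_sqrt_mul_sqrt Finset.univ u v

/-- The Frobenius norm dominates the Euclidean operator norm. -/
theorem sqrt_dotProduct_mulVec_le {p q : ℕ} (M : Matrix (Fin p) (Fin q) ℝ) (v : Fin q → ℝ) :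
    √((M *ᵥ v) ⬝ᵥ (M *ᵥ v)) ≤ frobNorm M * √(v ⬝ᵥ v) := by
  have hv : 0 ≤ v ⬝ᵥ v := Finset.sum_nonneg fun i _ => mul_self_nonneg (v i)
  rw [frobNorm, ← Real.sqrt_mul' _ hv]
  apply Real.sqrt_le_sqrt
  rw [trace_mul_comm, trace, Finset.sum_mul]
  refine Finset.sum_le_sum fun i _ => ?_
  simpa only [mulVec, dotProduct, pow_two, diag_apply, mul_apply, transpose_apply] using
    Finset.sum_mul_sq_le_sq_mul_sq Finset.univ (M i) v

/-- The quadratic form of a product is bounded by the product of the Frobenius norms. -/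
theorem dotProduct_mul_mulVec_le {p q : ℕ} (X : Matrix (Fin p) (Fin q) ℝ)
    (Y : Matrix (Fin q) (Fin p) ℝ) (v : Fin p → ℝ) :
    v ⬝ᵥ ((X * Y) *ᵥ v) ≤ frobNorm X * frobNorm Y * (v ⬝ᵥ v) := by
  have hv : 0 ≤ v ⬝ᵥ v := Finset.sum_nonneg fun i _ => mul_self_nonneg (v i)
  have hX : 0 ≤ frobNorm X := Real.sqrt_nonneg _
  rw [← mulVec_mulVec]
  calc v ⬝ᵥ (X *ᵥ (Y *ᵥ v))
      ≤ √(v ⬝ᵥ v) * √((X *ᵥ (Y *ᵥ v)) ⬝ᵥ (X *ᵥ (Y *ᵥ v))) := dotProduct_le_sqrt_mul_sqrt _ _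
    _ ≤ √(v ⬝ᵥ v) * (frobNorm X * √((Y *ᵥ v) ⬝ᵥ (Y *ᵥ v))) := by
        gcongr; exact sqrt_dotProduct_mulVec_le _ _
    _ ≤ √(v ⬝ᵥ v) * (frobNorm X * (frobNorm Y * √(v ⬝ᵥ v))) := by
        gcongr; exact sqrt_dotProduct_mulVec_le _ _
    _ = frobNorm X * frobNorm Y * (√(v ⬝ᵥ v) * √(v ⬝ᵥ v)) := by ring
    _ = frobNorm X * frobNorm Y * (v ⬝ᵥ v) := by rw [Real.mul_self_sqrt hv]

/-- Lyapunov's criterion: if `v ↦ vᵀ S M v` is negative definite for some positive definite `S`,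
then `M` is Hurwitz. -/
theorem isHurwitz_of_lyapunov {N : ℕ} {M S : Matrix (Fin N) (Fin N) ℝ} (hS : S.PosDef)
    (h : ∀ v : Fin N → ℝ, v ≠ 0 → v ⬝ᵥ ((S * M) *ᵥ v) < 0) : IsHurwitz M := by
  intro μ hμ
  rw [← Matrix.spectrum_toLin', ← Module.End.hasEigenvalue_iff_mem_spectrum] at hμ
  obtain ⟨z, hz⟩ := hμ.exists_hasEigenvector
  have hz_eq : (M.map (algebraMap ℝ ℂ)) *ᵥ z = μ • z := by simpa using hz.apply_eq_smul
  set x : Fin N → ℝ := fun i => (z i).re with hx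
  set y : Fin N → ℝ := fun i => (z i).im with hy
  have hMx : M *ᵥ x = μ.re • x - μ.im • y := by
    ext i
    have := congrArg Complex.re (congrFun hz_eq i)
    simpa [mulVec, dotProduct, hx, hy] using this
  have hMy : M *ᵥ y = μ.im • x + μ.re • y := by
    ext i
    have := congrArg Complex.im (congrFun hz_eq i)
    simp [mulVec, dotProduct, hx, hy] at this ⊢
    linarith
  have hsymm : x ⬝ᵥ (S *ᵥ y) = y ⬝ᵥ (S *ᵥ x) := by
    have hT : Sᵀ = S := by simpa [conjTranspose_eq_transpose_of_trivial] using hS.isHermitian.eq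
    rw [dotProduct_mulVec, ← mulVec_transpose, hT, dotProduct_comm]
  have hkey : x ⬝ᵥ ((S * M) *ᵥ x) + y ⬝ᵥ ((S * M) *ᵥ y)
      = μ.re * (x ⬝ᵥ (S *ᵥ x) + y ⬝ᵥ (S *ᵥ y)) := by
    rw [← mulVec_mulVec, ← mulVec_mulVec, hMx, hMy]
    simp only [mulVec_sub, mulVec_add, mulVec_smul, dotProduct_sub, dotProduct_add,
      dotProduct_smul, smul_eq_mul, hsymm]
    ring
  have hS_nonneg : ∀ v : Fin N → ℝ, 0 ≤ v ⬝ᵥ (S *ᵥ v) := fun v => by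
    simpa using hS.posSemidef.dotProduct_mulVec_nonneg v
  have h_nonpos : ∀ v : Fin N → ℝ, v ⬝ᵥ ((S * M) *ᵥ v) ≤ 0 := fun v => by
    by_cases hv : v = 0
    · simp [hv]
    · exact (h v hv).le
  have hneg : x ⬝ᵥ ((S * M) *ᵥ x) + y ⬝ᵥ ((S * M) *ᵥ y) < 0 := by
    by_cases hx0 : x = 0
    · have hy0 : y ≠ 0 := fun hy0 => hz.2 <| funext fun i =>
        Complex.ext (congrFun hx0 i) (congrFun hy0 i)
      exact add_neg_of_nonpos_of_neg (h_nonpos x) (h y hy0)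
    · exact add_neg_of_neg_of_nonpos (h x hx0) (h_nonpos y)
  exact neg_of_mul_neg_left (hkey ▸ hneg) (add_nonneg (hS_nonneg x) (hS_nonneg y))

/-- a smallness condition on `Λ` and `K − K*` relative to the
Lyapunov certificate `S` guarantees `A + BuΛ + BaK` is Hurwitz. -/
theorem stmt18
    (A : Matrix (Fin n) (Fin n) ℝ) (Bu : Matrix (Fin n) (Fin m_u) ℝ)
    (Ba : Matrix (Fin n) (Fin m_a) ℝ)
    (Q : Matrix (Fin n) (Fin n) ℝ) (R : Matrix (Fin m_a) (Fin m_a) ℝ)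
    (hQ : Q.PosDef) (hR : R.PosDef)
    (P : Matrix (Fin n) (Fin n) ℝ) (hP : P.PosDef)
    (hPeq : Aᵀ * P + P * A + Q + P * Ba * R⁻¹ * Baᵀ * P = 0)
    (hPstab : IsHurwitz (A + Ba * R⁻¹ * Baᵀ * P))
    (S : Matrix (Fin n) (Fin n) ℝ) (hS : S.PosDef)
    (hSeq : (A + Ba * (R⁻¹ * Baᵀ * P))ᵀ * S + S * (A + Ba * (R⁻¹ * Baᵀ * P))
      + (2 : ℝ) • (1 : Matrix (Fin n) (Fin n) ℝ) = 0)
    (Λ : Matrix (Fin m_u) (Fin n) ℝ) (K : Matrix (Fin m_a) (Fin n) ℝ)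
    (hsmall : frobNorm (S * Bu) * frobNorm Λ +
      frobNorm (S * Ba) * frobNorm (K - R⁻¹ * Baᵀ * P) < 1) :
    IsHurwitz (A + Bu * Λ + Ba * K) := by
  refine isHurwitz_of_lyapunov hS fun v hv => ?_
  set Kstar := R⁻¹ * Baᵀ * P with hKstar
  have hsplit : S * (A + Bu * Λ + Ba * K)
      = S * (A + Ba * Kstar) + S * Bu * Λ + S * Ba * (K - Kstar) := by
    simp only [Matrix.mul_add, Matrix.mul_sub, Matrix.mul_assoc]
    abel
  have hT : Sᵀ = S := by simpa [conjTranspose_eq_transpose_of_trivial] using hS.isHermitian.eq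
  have hform : v ⬝ᵥ ((S * (A + Ba * Kstar)) *ᵥ v) = -(v ⬝ᵥ v) := by
    have hquad := congrArg (fun X => v ⬝ᵥ (X *ᵥ v)) hSeq
    have htrans : v ⬝ᵥ (((A + Ba * Kstar)ᵀ * S) *ᵥ v) = v ⬝ᵥ ((S * (A + Ba * Kstar)) *ᵥ v) := by
      rw [← hT, ← transpose_mul, hT, mulVec_transpose, dotProduct_comm, ← dotProduct_mulVec]
    simp only [add_mulVec, dotProduct_add, htrans, smul_mulVec, one_mulVec, dotProduct_smul,
      smul_eq_mul, zero_mulVec, dotProduct_zero] at hquad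
    linarith
  have hv_pos : 0 < v ⬝ᵥ v := by simpa using dotProduct_star_self_pos_iff.2 hv
  rw [hsplit, add_mulVec, add_mulVec, dotProduct_add, dotProduct_add, hform]
  have hu := dotProduct_mul_mulVec_le (S * Bu) Λ v
  have ha := dotProduct_mul_mulVec_le (S * Ba) (K - Kstar) v
  nlinarith [mul_lt_mul_of_pos_right hsmall hv_pos]
end
end
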